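/- Let T be a tree on n = 2k+1 vertices (k ≥ 2) with diameter 2k−1. Then ϱ(T) ≥ ϱ(T_1), where T_1 is the path v_k ⋯ v_1 u_1 ⋯ u_k with a single pendant vertex attached at v_1, with equality if and only if T ≅ T_1. -/

import Mathlib

open SimpleGraph

/-- The distance matrix of a graph: the (i,j)-entry is the graph distance between i and j. -/
noncomputable def distMatrix {V : Type*} [Fintype V] (G : SimpleGraph V) : Matrix V V ℝ :=
  fun i j => (G.dist i j : ℝ)

/-- The distance spectral radius: the largest eigenvalue of the distance matrix. -/
noncomputable def distSpectralRadius {V : Type*} [Fintype V] (G : SimpleGraph V) : ℝ :=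
  sSup {μ : ℝ | ∃ X : V → ℝ, X ≠ 0 ∧ (distMatrix G).mulVec X = μ • X}

/-- The distance Perron vector: the positive unit eigenvector of the distance matrix
corresponding to the distance spectral radius. -/
def IsDistPerronVector {V : Type*} [Fintype V] (G : SimpleGraph V) (X : V → ℝ) : Prop :=
  (∀ v, 0 < X v) ∧ (∑ v, (X v) ^ 2 = 1) ∧
    (distMatrix G).mulVec X = distSpectralRadius G • X

/-- The tree `T₁`: the path `v_k ⋯ v_1 u_1 ⋯ u_k` on `2k` vertices together with `m`
pendant vertices attached at `v_1`.  Here `Sum.inl i` is `v_{i+1}`, `Sum.inr (Sum.inl i)`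
is `u_{i+1}`, and `Sum.inr (Sum.inr j)` are the pendant vertices. -/
def treeT1 (k m : ℕ) : SimpleGraph (Fin k ⊕ (Fin k ⊕ Fin m)) :=
  SimpleGraph.fromRel (fun a b =>
    match a, b with
    | Sum.inl i, Sum.inl j => (i : ℕ) + 1 = (j : ℕ)
    | Sum.inr (Sum.inl i), Sum.inr (Sum.inl j) => (i : ℕ) + 1 = (j : ℕ)
    | Sum.inl i, Sum.inr (Sum.inl j) => (i : ℕ) = 0 ∧ (j : ℕ) = 0
    | Sum.inl i, Sum.inr (Sum.inr _) => (i : ℕ) = 0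
    | _, _ => False)


open Matrix in
lemma aux_spec {V : Type*} [Fintype V] [Nonempty V] (A : Matrix V V ℝ) (hA : A.IsHermitian) :
    ∃ r : ℝ, r = sSup {μ : ℝ | ∃ X : V → ℝ, X ≠ 0 ∧ A.mulVec X = μ • X} ∧
      (∃ X : V → ℝ, X ≠ 0 ∧ A.mulVec X = r • X) ∧
      (∀ X : V → ℝ, X ⬝ᵥ (A *ᵥ X) ≤ r * (X ⬝ᵥ X)) ∧
      (∀ X : V → ℝ, X ⬝ᵥ (A *ᵥ X) = r * (X ⬝ᵥ X) → A *ᵥ X = r • X) := by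
  classical
  set S := {μ : ℝ | ∃ X : V → ℝ, X ≠ 0 ∧ A.mulVec X = μ • X} with hS
  have hfin : S.Finite := by
    refine (Module.End.finite_hasEigenvalue (Matrix.toLin' A)).subset ?_
    rintro μ ⟨X, hX, h⟩
    exact Module.End.hasEigenvalue_of_hasEigenvector (x := X)
      ⟨Module.End.mem_eigenspace_iff.2 (by simpa using h), hX⟩
  have hne : S.Nonempty := by
    obtain ⟨j⟩ := ‹Nonempty V›
    refine ⟨hA.eigenvalues j, (hA.eigenvectorBasis j).ofLp, ?_, hA.mulVec_eigenvectorBasis j⟩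
    intro h
    have := hA.eigenvectorBasis.orthonormal.ne_zero j
    exact this (by ext i; exact congrFun h i)
  have hmem : sSup S ∈ S := hne.csSup_mem hfin
  set r := sSup S with hr
  have hB : (r • (1 : Matrix V V ℝ) - A).IsHermitian := by
    apply Matrix.IsHermitian.sub _ hA
    ext i j
    simp [Matrix.one_apply, eq_comm]
  have hmul : ∀ X : V → ℝ, (r • (1 : Matrix V V ℝ) - A) *ᵥ X = r • X - A *ᵥ X := by
    intro X
    rw [Matrix.sub_mulVec, Matrix.smul_mulVec, Matrix.one_mulVec]
  have hpsd : (r • (1 : Matrix V V ℝ) - A).PosSemidef := by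
    rw [hB.posSemidef_iff_eigenvalues_nonneg]
    intro j
    have h1 := hB.mulVec_eigenvectorBasis j
    rw [hmul] at h1
    have h2 : r - hB.eigenvalues j ∈ S := by
      refine ⟨(hB.eigenvectorBasis j).ofLp, ?_, ?_⟩
      · intro h
        have := hB.eigenvectorBasis.orthonormal.ne_zero j
        exact this (by ext i; exact congrFun h i)
      · rw [sub_smul, ← h1]; abel
    have := le_csSup hfin.bddAbove h2
    simp only [Pi.zero_apply]
    linarith
  have hq : ∀ X : V → ℝ, star X ⬝ᵥ ((r • (1 : Matrix V V ℝ) - A) *ᵥ X) =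
      r * (X ⬝ᵥ X) - X ⬝ᵥ (A *ᵥ X) := by
    intro X
    rw [hmul, dotProduct_sub, dotProduct_smul]; simp
  refine ⟨r, rfl, hmem, ?_, ?_⟩
  · intro X
    have := hpsd.dotProduct_mulVec_nonneg X
    rw [hq] at this
    linarith
  · intro X h
    have := (hpsd.dotProduct_mulVec_zero_iff X).1 (by rw [hq]; linarith)
    rw [hmul, sub_eq_zero] at this
    exact this.symm

lemma distMatrix_herm {V : Type*} [Fintype V] (G : SimpleGraph V) : (distMatrix G).IsHermitian := by
  ext i j
  simp [distMatrix, SimpleGraph.dist_comm]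

open Matrix in
lemma rayleigh_le {V : Type*} [Fintype V] [Nonempty V] (G : SimpleGraph V) (X : V → ℝ) :
    X ⬝ᵥ (distMatrix G *ᵥ X) ≤ distSpectralRadius G * (X ⬝ᵥ X) := by
  obtain ⟨r, h1, -, h2, -⟩ := aux_spec (distMatrix G) (distMatrix_herm G)
  rw [show distSpectralRadius G = r from h1.symm]
  exact h2 X

open Matrix in
lemma exists_perron {V : Type*} [Fintype V] [Nontrivial V] (G : SimpleGraph V) (hG : G.Connected) :
    ∃ X : V → ℝ, (∀ v, 0 < X v) ∧ distMatrix G *ᵥ X = distSpectralRadius G • X ∧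
      0 < distSpectralRadius G := by
  classical
  obtain ⟨r, h1, ⟨Y, hY0, hY⟩, h2, h3⟩ := aux_spec (distMatrix G) (distMatrix_herm G)
  rw [show distSpectralRadius G = r from h1.symm]
  set X : V → ℝ := fun v => |Y v| with hX
  have hXX : X ⬝ᵥ X = Y ⬝ᵥ Y := by simp [dotProduct, hX]
  have hge : r * (X ⬝ᵥ X) ≤ X ⬝ᵥ (distMatrix G *ᵥ X) := by
    have : Y ⬝ᵥ (distMatrix G *ᵥ Y) = r * (Y ⬝ᵥ Y) := by rw [hY, dotProduct_smul]; simp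
    rw [hXX, ← this]
    simp only [dotProduct, mulVec, Finset.mul_sum]
    refine Finset.sum_le_sum fun i _ => Finset.sum_le_sum fun j _ => ?_
    have hd : 0 ≤ distMatrix G i j := by simp [distMatrix]
    calc Y i * (distMatrix G i j * Y j) ≤ |Y i * (distMatrix G i j * Y j)| := le_abs_self _
      _ = _ := by rw [abs_mul, abs_mul, abs_of_nonneg hd]
  have hE := h3 X (le_antisymm (h2 X) hge)
  have hXn : ∀ v, 0 ≤ X v := fun v => abs_nonneg _
  obtain ⟨a, ha⟩ : ∃ a, 0 < X a := by
    by_contra! h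
    apply hY0
    ext v
    have := le_antisymm (h v) (hXn v)
    simpa [hX] using this
  have hsum : ∀ v, v ≠ a → 0 < r * X v := by
    intro v hv
    have := congrFun hE v
    simp only [Pi.smul_apply, smul_eq_mul] at this
    rw [← this]
    have hp : 0 < distMatrix G v a * X a := by
      apply mul_pos _ ha
      simpa [distMatrix] using hG.pos_dist_of_ne hv
    refine lt_of_lt_of_le hp ?_
    exact Finset.single_le_sum (f := fun j => distMatrix G v j * X j)
      (fun j _ => mul_nonneg (by simp [distMatrix]) (hXn j)) (Finset.mem_univ a)
  obtain ⟨b, hb⟩ := exists_ne a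
  have hr : 0 < r := pos_of_mul_pos_left (hsum b hb) (hXn b)
  refine ⟨X, fun v => ?_, hE, hr⟩
  by_cases hv : v = a
  · rwa [hv]
  · exact pos_of_mul_pos_right (hsum v hv) hr.le

lemma iso_dist {V W : Type*} {G : SimpleGraph V} {H : SimpleGraph W} (f : G ≃g H) (hG : G.Connected)
    (hH : H.Connected) (a b : V) : H.dist (f a) (f b) = G.dist a b := by
  apply le_antisymm
  · obtain ⟨p, hp⟩ := hG.exists_walk_length_eq_dist a b
    rw [← hp]
    have := H.dist_le (p.map f.toHom)
    simpa using this
  · obtain ⟨p, hp⟩ := hH.exists_walk_length_eq_dist (f a) (f b)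
    rw [← hp]
    have := G.dist_le (p.map f.symm.toHom)
    simpa using this

lemma iso_radius {V W : Type*} [Fintype V] [Fintype W] {G : SimpleGraph V} {H : SimpleGraph W}
    (f : G ≃g H) (hG : G.Connected) : distSpectralRadius G = distSpectralRadius H := by
  have hH : H.Connected := f.connected_iff.1 hG
  have hmv : ∀ X : W → ℝ, ∀ v, (distMatrix G).mulVec (X ∘ f) v = (distMatrix H).mulVec X (f v) := by
    intro X v
    simp only [Matrix.mulVec, dotProduct, distMatrix]
    rw [← Equiv.sum_comp f.toEquiv]
    refine Finset.sum_congr rfl fun j _ => ?_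
    simp [← iso_dist f hG hH]
  unfold distSpectralRadius
  congr 1
  ext μ
  constructor
  · rintro ⟨X, hX, h⟩
    refine ⟨X ∘ f.symm, ?_, ?_⟩
    · intro h0
      apply hX
      ext v
      simpa using congrFun h0 (f v)
    · ext w
      have h1 := hmv (X ∘ f.symm) (f.symm w)
      have h2 : (X ∘ f.symm) ∘ f = X := by ext v; simp
      rw [h2, h] at h1
      simpa using h1.symm
  · rintro ⟨X, hX, h⟩
    refine ⟨X ∘ f, ?_, ?_⟩
    · intro h0
      apply hX
      ext w
      simpa using congrFun h0 (f.symm w)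
    · ext v
      rw [hmv, h]; simp

/-- Path on `n` vertices with a pendant vertex `none` attached at position `p`. -/
def catG (n p : ℕ) : SimpleGraph (Option (Fin n)) where
  Adj a b := match a, b with
    | some i, some j => (i : ℕ) + 1 = j ∨ (j : ℕ) + 1 = i
    | some i, none => (i : ℕ) = p
    | none, some i => (i : ℕ) = p
    | none, none => False
  symm := ⟨by
    rintro (_ | i) (_ | j) h
    · exact h
    · exact h
    · exact h
    · exact h.symm⟩
  loopless := ⟨by
    rintro (_ | i) h
    · exact h
    · simp at h⟩

/-- Distance function of `catG`. -/
def catD (n p : ℕ) : Option (Fin n) → Option (Fin n) → ℤ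
  | some i, some j => |(i : ℤ) - j|
  | some i, none => |(i : ℤ) - p| + 1
  | none, some i => |(i : ℤ) - p| + 1
  | none, none => 0

lemma catG_walk (n p : ℕ) : ∀ d : ℕ, ∀ i j : Fin n, (i : ℕ) + d = j →
    ∃ w : (catG n p).Walk (some i) (some j), w.length = d := by
  intro d
  induction d with
  | zero =>
    intro i j h
    obtain rfl : i = j := Fin.ext (by simpa using h)
    exact ⟨SimpleGraph.Walk.nil, rfl⟩
  | succ d ih =>
    intro i j h
    have hi : (i : ℕ) + 1 < n := by have := j.2; omega
    obtain ⟨w, hw⟩ := ih ⟨i + 1, hi⟩ j (by simp; omega)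
    have hadj : (catG n p).Adj (some i) (some ⟨i + 1, hi⟩) := Or.inl rfl
    exact ⟨SimpleGraph.Walk.cons hadj w, by simp [hw]⟩

lemma catG_walk' (n p : ℕ) (i j : Fin n) :
    ∃ w : (catG n p).Walk (some i) (some j), (w.length : ℤ) = |(i : ℤ) - j| := by
  rcases le_total (i : ℕ) j with h | h
  · obtain ⟨w, hw⟩ := catG_walk n p (j - i) i j (by omega)
    exact ⟨w, by rw [hw, abs_eq_max_neg]; omega⟩
  · obtain ⟨w, hw⟩ := catG_walk n p (i - j) j i (by omega)
    exact ⟨w.reverse, by rw [SimpleGraph.Walk.length_reverse, hw, abs_eq_max_neg]; omega⟩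

lemma catG_walk_ex (n p : ℕ) (hp : p < n) (a b : Option (Fin n)) :
    ∃ w : (catG n p).Walk a b, (w.length : ℤ) = catD n p a b := by
  rcases a with _ | i <;> rcases b with _ | j
  · exact ⟨SimpleGraph.Walk.nil, rfl⟩
  · obtain ⟨w, hw⟩ := catG_walk' n p ⟨p, hp⟩ j
    have hadj : (catG n p).Adj none (some ⟨p, hp⟩) := rfl
    refine ⟨SimpleGraph.Walk.cons hadj w, ?_⟩
    simp only [SimpleGraph.Walk.length_cons, catD]
    push_cast
    rw [hw, abs_sub_comm]
  · obtain ⟨w, hw⟩ := catG_walk' n p ⟨p, hp⟩ i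
    have hadj : (catG n p).Adj none (some ⟨p, hp⟩) := rfl
    refine ⟨(SimpleGraph.Walk.cons hadj w).reverse, ?_⟩
    simp only [SimpleGraph.Walk.length_reverse, SimpleGraph.Walk.length_cons, catD]
    push_cast
    rw [hw, abs_sub_comm]
  · exact catG_walk' n p i j

lemma catD_lip (n p : ℕ) (a b c : Option (Fin n)) (h : (catG n p).Adj a b) :
    catD n p a c ≤ catD n p b c + 1 := by
  rcases a with _ | i <;> rcases b with _ | j <;> rcases c with _ | l <;>
    simp only [catG, catD, abs_eq_max_neg] at h ⊢ <;> omega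

lemma catD_le (n p : ℕ) {a b : Option (Fin n)} (w : (catG n p).Walk a b) :
    catD n p a b ≤ w.length := by
  induction w with
  | @nil u => rcases u with _ | i <;> simp [catD]
  | @cons u v x h w ih =>
    have := catD_lip n p u v x h
    simp only [SimpleGraph.Walk.length_cons]
    push_cast
    omega

lemma catG_conn (n p : ℕ) (hp : p < n) : (catG n p).Connected := by
  have : Nonempty (Option (Fin n)) := ⟨none⟩
  refine SimpleGraph.Connected.mk ?_
  intro a b
  obtain ⟨w, -⟩ := catG_walk_ex n p hp a b
  exact ⟨w⟩

lemma catG_dist (n p : ℕ) (hp : p < n) (a b : Option (Fin n)) :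
    (((catG n p).dist a b : ℕ) : ℤ) = catD n p a b := by
  apply le_antisymm
  · obtain ⟨w, hw⟩ := catG_walk_ex n p hp a b
    rw [← hw]
    exact_mod_cast SimpleGraph.dist_le w
  · obtain ⟨w, hw⟩ := (catG_conn n p hp).exists_walk_length_eq_dist a b
    rw [← hw]
    exact catD_le n p w

/-- Reflection. -/
def catG_rev (n p q : ℕ) (h : p + q + 1 = n) : catG n p ≃g catG n q where
  toEquiv := Equiv.optionCongr Fin.revPerm
  map_rel_iff' := by
    rintro (_ | i) (_ | j) <;> simp [catG] <;> omega

/-- The tree `T₁` as a `catG`. -/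
def t1Equiv (k : ℕ) : Option (Fin (2 * k)) → Fin k ⊕ (Fin k ⊕ Fin 1)
  | none => Sum.inr (Sum.inr 0)
  | some i => if h : (i : ℕ) < k then Sum.inl ⟨k - 1 - i, by omega⟩
      else Sum.inr (Sum.inl ⟨i - k, by omega⟩)

lemma t1_iso (k : ℕ) (hk : 2 ≤ k) : Nonempty (catG (2 * k) (k - 1) ≃g treeT1 k 1) := by
  have hinj : Function.Injective (t1Equiv k) := by
    rintro (_ | i) (_ | j) h
    · rfl
    · simp only [t1Equiv] at h; split_ifs at h <;> simp at h
    · simp only [t1Equiv] at h; split_ifs at h <;> simp at h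
    · simp only [t1Equiv] at h
      split_ifs at h <;> simp at h <;> congr 1 <;> ext <;> omega
  have hbij : Function.Bijective (t1Equiv k) := by
    rw [Fintype.bijective_iff_injective_and_card]
    refine ⟨hinj, ?_⟩
    simp; omega
  refine ⟨⟨Equiv.ofBijective _ hbij, ?_⟩⟩
  rintro (_ | i) (_ | j) <;>
    simp only [Equiv.ofBijective_apply, t1Equiv, treeT1, catG, SimpleGraph.fromRel_adj]
  · simp
  · split_ifs <;> simp <;> omega
  · split_ifs <;> simp <;> omega
  · split_ifs <;> simp <;> omega

lemma sum_step (n : ℕ) (x : ℕ → ℝ) (i : ℕ) (hi : i < n) :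
    ∑ j ∈ Finset.range n, (|(i : ℝ) - j| - |((i + 1 : ℕ) : ℝ) - j|) * x j =
      ∑ j ∈ Finset.range n, x j - 2 * ∑ j ∈ Finset.range (i + 1), x j := by
  obtain ⟨m, rfl⟩ : ∃ m, n = (i + 1) + m := ⟨n - (i + 1), by omega⟩
  rw [Finset.sum_range_add _ (i + 1) m, Finset.sum_range_add x (i + 1) m]
  have h1 : ∑ j ∈ Finset.range (i + 1), (|(i : ℝ) - j| - |((i + 1 : ℕ) : ℝ) - j|) * x j =
      - ∑ j ∈ Finset.range (i + 1), x j := by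
    rw [← Finset.sum_neg_distrib]
    refine Finset.sum_congr rfl fun j hj => ?_
    have : (j : ℝ) ≤ i := by
      have := Finset.mem_range.1 hj
      exact_mod_cast (by omega : j ≤ i)
    push_cast
    rw [abs_of_nonneg (by linarith), abs_of_nonneg (by linarith)]
    ring
  have h2 : ∑ j ∈ Finset.range m, (|(i : ℝ) - ((i + 1 + j : ℕ) : ℝ)| -
      |((i + 1 : ℕ) : ℝ) - ((i + 1 + j : ℕ) : ℝ)|) * x (i + 1 + j) =
      ∑ j ∈ Finset.range m, x (i + 1 + j) := by
    refine Finset.sum_congr rfl fun j _ => ?_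
    have : (0 : ℝ) ≤ j := by positivity
    push_cast
    rw [abs_of_nonpos (by linarith), abs_of_nonpos (by linarith)]
    ring
  rw [h1, h2]
  ring

/-- Key computation: with `w` at the centre, the half sums compare. -/
lemma half_sum (k : ℕ) (hk : 2 ≤ k) (x P : ℕ → ℝ) (w r : ℝ) (hw : 0 < w) (hr : 0 < r)
    (hP : ∀ m, P (m + 1) = P m + x m) (hP0 : P 0 = 0)
    (hL : ∀ i, i + 1 < k → r * (x i - x (i + 1)) = P (2 * k) - 2 * P (i + 1) + w)
    (hR : ∀ i, k ≤ i + 1 → i + 1 < 2 * k →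
      r * (x i - x (i + 1)) = P (2 * k) - 2 * P (i + 1) - w) :
    0 < P (2 * k) - 2 * P k := by
  by_contra! hcon
  have key : ∀ j, j < k → 0 < x (k + j) - x (k - 1 - j) ∧
      0 < P (k + j + 1) + P (k - 1 - j) - 2 * P k := by
    intro j
    induction j with
    | zero =>
      intro _
      have h := hR (k - 1) (by omega) (by omega)
      have hp := hP (k - 1)
      have hp' := hP k
      rw [show k - 1 + 1 = k by omega] at h hp
      have h1 : 0 < x (k + 0) - x (k - 1 - 0) := by
        simp only [add_zero, tsub_zero]
        refine pos_of_mul_pos_right (b := x k - x (k - 1)) (a := r) ?_ hr.le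
        linarith
      refine ⟨h1, ?_⟩
      simp only [add_zero, tsub_zero] at h1 ⊢
      linarith
    | succ j ih =>
      intro hj
      obtain ⟨i1, i2⟩ := ih (by omega)
      have h := hR (k + j) (by omega) (by omega)
      have h' := hL (k - 1 - (j + 1)) (by omega)
      have hp := hP (k - 1 - (j + 1))
      have hp' := hP (k + (j + 1))
      rw [show k - 1 - (j + 1) + 1 = k - 1 - j by omega] at h' hp
      rw [show k + j + 1 = k + (j + 1) by omega] at h i2
      have h1 : 0 < (x (k + (j + 1)) - x (k - 1 - (j + 1))) - (x (k + j) - x (k - 1 - j)) := by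
        refine pos_of_mul_pos_right (a := r) ?_ hr.le
        linarith
      refine ⟨by linarith, by linarith⟩
  obtain ⟨-, h⟩ := key (k - 1) (by omega)
  rw [show k + (k - 1) + 1 = 2 * k by omega, show k - 1 - (k - 1) = 0 by omega, hP0] at h
  linarith

lemma sum_pos_main (k : ℕ) (hk : 2 ≤ k) (x : ℕ → ℝ) (w r : ℝ) (hw : 0 < w) (hr : 0 < r)
    (hx : ∀ i, i < 2 * k → 0 < x i)
    (hE : ∀ i, i < 2 * k → r * x i = ∑ j ∈ Finset.range (2 * k), |(i : ℝ) - j| * x j +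
      (|(i : ℝ) - ((k - 1 : ℕ) : ℝ)| + 1) * w) (p : ℕ) (hp : p < k - 1) :
    0 < ∑ j ∈ Finset.range (2 * k), (|(p : ℝ) - j| - |((k - 1 : ℕ) : ℝ) - j|) * x j := by
  set P : ℕ → ℝ := fun m => ∑ j ∈ Finset.range m, x j with hPd
  have hdiff : ∀ i, i + 1 < 2 * k → r * (x i - x (i + 1)) = P (2 * k) - 2 * P (i + 1) +
      (|(i : ℝ) - ((k - 1 : ℕ) : ℝ)| - |((i + 1 : ℕ) : ℝ) - ((k - 1 : ℕ) : ℝ)|) * w := by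
    intro i hi
    have h1 := hE i (by omega)
    have h2 := hE (i + 1) hi
    have h3 := sum_step (2 * k) x i (by omega)
    simp only [sub_mul, Finset.sum_sub_distrib] at h3
    simp only [hPd]
    linarith
  have hhalf : 0 < P (2 * k) - 2 * P k := by
    refine half_sum k hk x P w r hw hr (fun m => Finset.sum_range_succ _ _) (by simp [hPd]) ?_ ?_
    · intro i hi
      rw [hdiff i (by omega)]
      have : ((i + 1 : ℕ) : ℝ) ≤ ((k - 1 : ℕ) : ℝ) := by exact_mod_cast (by omega)
      push_cast at this ⊢
      rw [abs_of_nonpos (by linarith), abs_of_nonpos (by linarith)]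
      ring
    · intro i hi hi'
      rw [hdiff i (by omega)]
      have : ((k - 1 : ℕ) : ℝ) ≤ (i : ℝ) := by exact_mod_cast (by omega)
      push_cast at this ⊢
      rw [abs_of_nonneg (by linarith), abs_of_nonneg (by linarith)]
      ring
  have hmono : ∀ m, m ≤ k → P m ≤ P k := by
    intro m hm
    refine Finset.sum_le_sum_of_subset_of_nonneg ?_ ?_
    · intro a; simp only [Finset.mem_range]; omega
    · intro a ha _
      exact (hx a (by have := Finset.mem_range.1 ha; omega)).le
  have hgen : ∀ d, p + (d + 1) ≤ k - 1 →
      0 < ∑ j ∈ Finset.range (2 * k), (|(p : ℝ) - j| - |((p + (d + 1) : ℕ) : ℝ) - j|) * x j := by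
    intro d
    induction d with
    | zero =>
      intro h
      rw [zero_add, sum_step (2 * k) x p (by omega)]
      have := hmono (p + 1) (by omega)
      simp only [hPd] at this hhalf
      linarith
    | succ d ih =>
      intro h
      have h1 := ih (by omega)
      have h2 := sum_step (2 * k) x (p + (d + 1)) (by omega)
      have h3 := hmono (p + (d + 1) + 1) (by omega)
      simp only [hPd] at h3 hhalf
      rw [show p + (d + 1 + 1) = p + (d + 1) + 1 by omega]
      simp only [sub_mul, Finset.sum_sub_distrib] at h1 h2 ⊢
      linarith
  have := hgen (k - 1 - p - 1) (by omega)
  rwa [show p + (k - 1 - p - 1 + 1) = k - 1 by omega] at this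

open Matrix in
lemma cat_lt (k : ℕ) (hk : 2 ≤ k) (p : ℕ) (hp : p < k - 1) :
    distSpectralRadius (catG (2 * k) (k - 1)) < distSpectralRadius (catG (2 * k) p) := by
  have : Nonempty (Fin (2 * k)) := ⟨⟨0, by omega⟩⟩
  obtain ⟨X, hX, hE, hr⟩ := exists_perron (catG (2 * k) (k - 1)) (catG_conn _ _ (by omega))
  set r := distSpectralRadius (catG (2 * k) (k - 1)) with hrd
  have hdm : ∀ q, q < 2 * k → ∀ a b, distMatrix (catG (2 * k) q) a b = (catD (2 * k) q a b : ℝ) := by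
    intro q hq a b
    rw [← catG_dist _ q hq]
    simp [distMatrix]
  set w := X none with hw
  set x : ℕ → ℝ := fun i => if h : i < 2 * k then X (some ⟨i, h⟩) else 0 with hx
  have hxs : ∀ i : Fin (2 * k), X (some i) = x i := by
    intro i; simp [hx]
  have hsum : ∀ f : ℕ → ℝ, ∑ i : Fin (2 * k), f i = ∑ i ∈ Finset.range (2 * k), f i :=
    fun f => Fin.sum_univ_eq_sum_range f (2 * k)
  have hsome : ∀ q, q < 2 * k → ∀ i : Fin (2 * k), (distMatrix (catG (2 * k) q) *ᵥ X) (some i) =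
      ∑ j ∈ Finset.range (2 * k), |((i : ℕ) : ℝ) - j| * x j + (|((i : ℕ) : ℝ) - q| + 1) * w := by
    intro q hq i
    rw [← hsum]
    simp only [mulVec, dotProduct, Fintype.sum_option, hdm q hq, catD, hxs]
    push_cast
    ring
  have hnone : ∀ q, q < 2 * k → (distMatrix (catG (2 * k) q) *ᵥ X) none =
      ∑ j ∈ Finset.range (2 * k), (|(q : ℝ) - j| + 1) * x j := by
    intro q hq
    rw [← hsum]
    simp only [mulVec, dotProduct, Fintype.sum_option, hdm q hq, catD, hxs]
    push_cast
    rw [zero_mul, zero_add]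
    exact Finset.sum_congr rfl fun j _ => by rw [abs_sub_comm]
  have hS := sum_pos_main k hk x w r (hX _) hr
    (fun i hi => by rw [← hxs ⟨i, hi⟩]; exact hX _)
    (fun i hi => by
      have h1 := congrFun hE (some ⟨i, hi⟩)
      rw [hsome _ (by omega)] at h1
      simp only [Pi.smul_apply, smul_eq_mul, hxs] at h1
      exact h1.symm) p hp
  set S := ∑ j ∈ Finset.range (2 * k), (|(p : ℝ) - j| - |((k - 1 : ℕ) : ℝ) - j|) * x j with hSd
  have hdiff : X ⬝ᵥ (distMatrix (catG (2 * k) p) *ᵥ X) -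
      X ⬝ᵥ (distMatrix (catG (2 * k) (k - 1)) *ᵥ X) = 2 * w * S := by
    simp only [dotProduct, Fintype.sum_option]
    rw [hnone p (by omega), hnone (k - 1) (by omega), ← hw]
    simp only [hsome p (by omega), hsome (k - 1) (by omega), hxs]
    rw [hsum (fun i => x i * (∑ j ∈ Finset.range (2 * k), |(i : ℝ) - j| * x j +
        (|(i : ℝ) - p| + 1) * w)), hsum (fun i => x i * (∑ j ∈ Finset.range (2 * k),
        |(i : ℝ) - j| * x j + (|(i : ℝ) - ((k - 1 : ℕ) : ℝ)| + 1) * w))]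
    have e1 : ∑ j ∈ Finset.range (2 * k), (|(p : ℝ) - j| + 1) * x j -
        ∑ j ∈ Finset.range (2 * k), (|((k - 1 : ℕ) : ℝ) - j| + 1) * x j = S := by
      rw [hSd, ← Finset.sum_sub_distrib]
      exact Finset.sum_congr rfl fun j _ => by ring
    have e2 : ∑ i ∈ Finset.range (2 * k), x i * (∑ j ∈ Finset.range (2 * k), |(i : ℝ) - j| * x j +
        (|(i : ℝ) - p| + 1) * w) - ∑ i ∈ Finset.range (2 * k), x i * (∑ j ∈ Finset.range (2 * k),
        |(i : ℝ) - j| * x j + (|(i : ℝ) - ((k - 1 : ℕ) : ℝ)| + 1) * w) = w * S := by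
      rw [hSd, ← Finset.sum_sub_distrib, Finset.mul_sum]
      exact Finset.sum_congr rfl fun j _ => by
        rw [abs_sub_comm (j : ℝ) p, abs_sub_comm (j : ℝ) ((k - 1 : ℕ) : ℝ)]; ring
    linear_combination w * e1 + e2
  have hray := rayleigh_le (catG (2 * k) p) X
  rw [hE, dotProduct_smul, smul_eq_mul] at hdiff
  have hXX : 0 < X ⬝ᵥ X :=
    Finset.sum_pos (fun i _ => mul_pos (hX i) (hX i)) Finset.univ_nonempty
  have hwS : 0 < 2 * w * S := by have := hX none; positivity
  have : r * (X ⬝ᵥ X) < distSpectralRadius (catG (2 * k) p) * (X ⬝ᵥ X) := by linarith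
  exact lt_of_mul_lt_mul_right this hXX.le

/-- In an acyclic graph two vertices on a geodesic cannot share an outside neighbour. -/
lemma no_short_cycle {V : Type*} {T : SimpleGraph V} (hacyc : T.IsAcyclic) {a b w : V}
    (hab : a ≠ b) (ha : T.Adj w a) (hb : T.Adj w b) :
    ¬ T.Adj a b ∧ ∀ c, c ≠ w → T.Adj a c → T.Adj c b → False := by
  have P1 : (SimpleGraph.Walk.cons ha.symm (SimpleGraph.Walk.cons hb SimpleGraph.Walk.nil)).IsPath := by
    simp [SimpleGraph.Walk.cons_isPath_iff, hab, ha.ne', hb.ne]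
  constructor
  · intro h
    have P2 : (SimpleGraph.Walk.cons h SimpleGraph.Walk.nil).IsPath := by
      simp [SimpleGraph.Walk.cons_isPath_iff, hab]
    have := (hacyc.subsingleton_path a b).elim ⟨_, P1⟩ ⟨_, P2⟩
    have := congrArg (fun q => q.1.length) this
    simp at this
  · intro c hc h1 h2
    have P2 : (SimpleGraph.Walk.cons h1 (SimpleGraph.Walk.cons h2 SimpleGraph.Walk.nil)).IsPath := by
      simp [SimpleGraph.Walk.cons_isPath_iff, hab, h1.ne, h2.ne]
    have := (hacyc.subsingleton_path a b).elim ⟨_, P1⟩ ⟨_, P2⟩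
    have := congrArg (fun q => q.1.support) this
    simp at this
    exact hc this.symm

lemma tree_shape {V : Type*} [Fintype V] (k : ℕ) (hk : 2 ≤ k)
    (T : SimpleGraph V) (hcard : Fintype.card V = 2 * k + 1)
    (hconn : T.Connected) (hacyc : T.IsAcyclic) (hdiam : T.diam = 2 * k - 1) :
    ∃ p, p < 2 * k ∧ Nonempty (catG (2 * k) p ≃g T) := by
  classical
  have : Nonempty V := hconn.nonempty
  have : Nontrivial V := Fintype.one_lt_card_iff_nontrivial.1 (by omega)
  obtain ⟨u, v, huv⟩ := T.exists_dist_eq_diam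
  obtain ⟨W, hW⟩ := hconn.exists_walk_length_eq_dist u v
  have hlen : W.length = 2 * k - 1 := by omega
  set g : ℕ → V := W.getVert with hg
  have hadj : ∀ i, i + 1 < 2 * k → T.Adj (g i) (g (i + 1)) :=
    fun i hi => W.adj_getVert_succ (by omega)
  have hle : ∀ d i, i + d < 2 * k → T.dist (g i) (g (i + d)) ≤ d := by
    intro d
    induction d with
    | zero => intro i _; simp
    | succ d ih =>
      intro i hi
      have h1 := ih i (by omega)
      have h2 := SimpleGraph.dist_eq_one_iff_adj.2 (hadj (i + d) (by omega))
      have h3 := hconn.dist_triangle (u := g i) (v := g (i + d)) (w := g (i + d + 1))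
      rw [← add_assoc]
      omega
  have h0 : g 0 = u := by simp [hg]
  have hl : g (2 * k - 1) = v := by rw [hg, ← hlen]; simp
  have hdist : ∀ i j, i ≤ j → j < 2 * k → T.dist (g i) (g j) = j - i := by
    intro i j hij hj
    have a1 := hle i 0 (by omega)
    have a2 := hle (j - i) i (by omega)
    have a3 := hle (2 * k - 1 - j) j (by omega)
    rw [zero_add, h0] at a1
    rw [show i + (j - i) = j by omega] at a2
    rw [show j + (2 * k - 1 - j) = 2 * k - 1 by omega, hl] at a3
    have t1 := hconn.dist_triangle (u := u) (v := g i) (w := v)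
    have t2 := hconn.dist_triangle (u := g i) (v := g j) (w := v)
    omega
  have hginj : ∀ i j, i < 2 * k → j < 2 * k → g i = g j → i = j := by
    intro i j hi hj h
    rcases le_total i j with hij | hij
    · have := hdist i j hij hj
      rw [h, SimpleGraph.dist_self] at this
      omega
    · have := hdist j i hij hi
      rw [h, SimpleGraph.dist_self] at this
      omega
  have hgadj : ∀ i j, i < 2 * k → j < 2 * k → (T.Adj (g i) (g j) ↔ i + 1 = j ∨ j + 1 = i) := by
    intro i j hi hj
    rw [← SimpleGraph.dist_eq_one_iff_adj]
    rcases le_total i j with hij | hij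
    · rw [hdist i j hij hj]; omega
    · rw [SimpleGraph.dist_comm, hdist j i hij hi]; omega
  obtain ⟨w, hw⟩ : ∃ w, w ∉ (Finset.range (2 * k)).image g := by
    by_contra! h
    have h1 : Finset.univ ⊆ (Finset.range (2 * k)).image g := fun a _ => h a
    have h2 := Finset.card_le_card h1
    have h3 := Finset.card_image_le (s := Finset.range (2 * k)) (f := g)
    rw [Finset.card_univ] at h2
    rw [Finset.card_range] at h3
    omega
  have hwg : ∀ i, i < 2 * k → g i ≠ w := by
    intro i hi h
    exact hw (Finset.mem_image.2 ⟨i, Finset.mem_range.2 hi, h⟩)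
  set e : Option (Fin (2 * k)) → V := fun o => o.elim w (fun i => g i) with he
  have heinj : Function.Injective e := by
    rintro (_ | i) (_ | j) h
    · rfl
    · exact absurd h.symm (hwg j j.2)
    · exact absurd h (hwg i i.2)
    · exact congrArg some (Fin.ext (hginj i j i.2 j.2 h))
  have hebij : Function.Bijective e := by
    rw [Fintype.bijective_iff_injective_and_card]
    exact ⟨heinj, by simp [hcard]⟩
  obtain ⟨y, hy⟩ := hconn.preconnected.exists_adj_of_nontrivial w
  obtain ⟨o, rfl⟩ := hebij.2 y
  rcases o with _ | p
  · exact absurd hy (T.loopless.irrefl w)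
  have hyp : T.Adj w (g p) := hy
  have aux : ∀ i j, i < j → j < 2 * k → T.Adj w (g i) → T.Adj w (g j) → False := by
    intro i j hij hj h1 h2
    have hd := hdist i j hij.le hj
    have ht := hconn.dist_triangle (u := g i) (v := w) (w := g j)
    rw [SimpleGraph.dist_eq_one_iff_adj.2 h1.symm, SimpleGraph.dist_eq_one_iff_adj.2 h2, hd] at ht
    have hne : g i ≠ g j := fun h => by have := hginj i j (by omega) hj h; omega
    obtain ⟨c1, c2⟩ := no_short_cycle hacyc hne h1 h2
    rcases (by omega : j = i + 1 ∨ j = i + 2) with rfl | rfl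
    · exact c1 (hadj i (by omega))
    · exact c2 (g (i + 1)) (hwg _ (by omega)) (hadj i (by omega)) (hadj (i + 1) (by omega))
  have hwadj : ∀ i : Fin (2 * k), T.Adj w (g i) ↔ (i : ℕ) = p := by
    intro i
    constructor
    · intro h
      rcases lt_trichotomy (i : ℕ) p with h' | h' | h'
      · exact (aux i p h' p.2 h hyp).elim
      · exact h'
      · exact (aux p i h' i.2 hyp h).elim
    · intro h; rw [h]; exact hyp
  refine ⟨p, p.2, ⟨⟨Equiv.ofBijective e hebij, ?_⟩⟩⟩
  rintro (_ | i) (_ | j)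
  · simp [catG]
  · exact hwadj j
  · exact (T.adj_comm _ _).trans (hwadj i)
  · exact hgadj i j i.2 j.2

/-- The case `n = 2k + 1`: every tree on `2k + 1` vertices with diameter `2k - 1` has
distance spectral radius at least that of `T₁` (the path `v_k ⋯ v_1 u_1 ⋯ u_k` with one
pendant vertex at `v_1`), with equality iff it is isomorphic to `T₁`. -/
theorem stmt12 {V : Type*} [Fintype V] (k : ℕ) (hk : 2 ≤ k)
    (T : SimpleGraph V) (hcard : Fintype.card V = 2 * k + 1)
    (hconn : T.Connected) (hacyc : T.IsAcyclic) (hdiam : T.diam = 2 * k - 1) :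
    distSpectralRadius T ≥ distSpectralRadius (treeT1 k 1) ∧
    (distSpectralRadius T = distSpectralRadius (treeT1 k 1) ↔
      Nonempty (T ≃g treeT1 k 1)) := by
  obtain ⟨f⟩ := t1_iso k hk
  have hf := iso_radius f (catG_conn (2 * k) (k - 1) (by omega))
  obtain ⟨p, hp, ⟨e⟩⟩ := tree_shape k hk T hcard hconn hacyc hdiam
  obtain ⟨q, hq, ⟨e'⟩⟩ : ∃ q, q ≤ k - 1 ∧ Nonempty (catG (2 * k) q ≃g T) := by
    by_cases h : p ≤ k - 1
    · exact ⟨p, h, ⟨e⟩⟩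
    · exact ⟨2 * k - 1 - p, by omega, ⟨(catG_rev (2 * k) (2 * k - 1 - p) p (by omega)).trans e⟩⟩
  have he := iso_radius e' (catG_conn (2 * k) q (by omega))
  have hiso : Nonempty (T ≃g treeT1 k 1) → distSpectralRadius T = distSpectralRadius (treeT1 k 1) :=
    fun ⟨i⟩ => iso_radius i hconn
  rcases hq.lt_or_eq with h | h
  · have hlt := cat_lt k hk q h
    rw [hf, he] at hlt
    exact ⟨hlt.le, fun h' => absurd h' hlt.ne', hiso⟩
  · subst h
    have i : Nonempty (T ≃g treeT1 k 1) := ⟨e'.symm.trans f⟩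
    exact ⟨(hiso i).ge, fun _ => i, hiso⟩
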